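/- arXiv:0804.2300 — 5 statements merged into one kernel-verified Lean document; each statement's English description precedes it below -/
import Mathlib

section
/- Let n ≥ 2 and 1 ≤ k ≤ n. In Aut(F_n), the 2n−k−1 automorphisms γ_i (for 2 ≤ i ≤ k), λ_i and ρ_i (for k < i ≤ n) pairwise commute. -/
/-- Two automorphisms of a free group that fix `z` and multiply each generator on the left and on
the right by powers of `z` commute. -/
theorem FreeGroup.commute_of_zpow_mul_of_mul_zpow {α : Type*} {a b : MulAut (FreeGroup α)}
    {z : FreeGroup α} (ha : a z = z) (hb : b z = z)
    (ha' : ∀ j, ∃ p q : ℤ, a (of j) = z ^ p * of j * z ^ q)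
    (hb' : ∀ j, ∃ p q : ℤ, b (of j) = z ^ p * of j * z ^ q) : Commute a b := by
  apply MulEquiv.toMonoidHom_injective
  ext j
  obtain ⟨p, q, h⟩ := ha' j
  obtain ⟨r, s, h'⟩ := hb' j
  change a (b (of j)) = b (a (of j))
  rw [h, h']
  simp only [_root_.map_mul, map_zpow, ha, hb, h, h']
  calc z ^ r * (z ^ p * of j * z ^ q) * z ^ s
      = (z ^ r * z ^ p) * of j * (z ^ q * z ^ s) := by group
    _ = (z ^ p * z ^ r) * of j * (z ^ s * z ^ q) := by rw [zpow_mul_comm, zpow_mul_comm z q]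
    _ = z ^ p * (z ^ r * of j * z ^ s) * z ^ q := by group

/-- An automorphism of a free group that fixes all generators but one, and multiplies that one on
both sides by powers of `z`, multiplies every generator on both sides by powers of `z`. -/
theorem FreeGroup.exists_zpow_mul_mul_zpow {α : Type*} {a : MulAut (FreeGroup α)}
    {z : FreeGroup α} {i : α} (p q : ℤ) (hi : a (of i) = z ^ p * of i * z ^ q)
    (h : ∀ j, j ≠ i → a (of j) = of j) (j : α) :
    ∃ p q : ℤ, a (of j) = z ^ p * of j * z ^ q := by
  obtain rfl | hj := eq_or_ne j i
  · exact ⟨p, q, hi⟩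
  · exact ⟨0, 0, by simpa using h j hj⟩


/-- Let `n ≥ 2` and `1 ≤ k ≤ n`.  In `Aut(F_n)`, the `2n-k-1`
automorphisms `γ_i` (for `2 ≤ i ≤ k`), `λ_i` and `ρ_i` (for `k < i ≤ n`)
pairwise commute.  Generators `x_1, …, x_n` are indexed by `Fin n`
(so `x_1` corresponds to the index `⟨0, _⟩`, and `x_i` to `⟨i-1, _⟩`);
the automorphisms are specified by their values on the generators. -/
theorem partially_symmetric_generators_commute
    (n k : ℕ) (hn : 2 ≤ n) (hk1 : 1 ≤ k) (hkn : k ≤ n)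
    (γ lam ρ : Fin n → MulAut (FreeGroup (Fin n)))
    -- γ_i for 2 ≤ i ≤ k (indices 1 ≤ i.val < k):  x_i ↦ x_1⁻¹ x_i x_1, fixing other generators
    (hγ : ∀ i : Fin n, 1 ≤ (i : ℕ) → (i : ℕ) < k →
      γ i (FreeGroup.of i) =
        (FreeGroup.of (⟨0, by omega⟩ : Fin n))⁻¹ * FreeGroup.of i *
          FreeGroup.of (⟨0, by omega⟩ : Fin n) ∧
      ∀ j : Fin n, j ≠ i → γ i (FreeGroup.of j) = FreeGroup.of j)
    -- λ_i for k < i ≤ n (indices k ≤ i.val):  x_i ↦ x_1 x_i, fixing other generators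
    (hlam : ∀ i : Fin n, k ≤ (i : ℕ) →
      lam i (FreeGroup.of i) = FreeGroup.of (⟨0, by omega⟩ : Fin n) * FreeGroup.of i ∧
      ∀ j : Fin n, j ≠ i → lam i (FreeGroup.of j) = FreeGroup.of j)
    -- ρ_i for k < i ≤ n (indices k ≤ i.val):  x_i ↦ x_i x_1, fixing other generators
    (hρ : ∀ i : Fin n, k ≤ (i : ℕ) →
      ρ i (FreeGroup.of i) = FreeGroup.of i * FreeGroup.of (⟨0, by omega⟩ : Fin n) ∧
      ∀ j : Fin n, j ≠ i → ρ i (FreeGroup.of j) = FreeGroup.of j) :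
    ({a | ∃ i : Fin n, 1 ≤ (i : ℕ) ∧ (i : ℕ) < k ∧ a = γ i} ∪
     {a | ∃ i : Fin n, k ≤ (i : ℕ) ∧ a = lam i} ∪
     {a | ∃ i : Fin n, k ≤ (i : ℕ) ∧ a = ρ i} :
       Set (MulAut (FreeGroup (Fin n)))).Pairwise Commute := by
  have key : ∀ a ∈ ({a | ∃ i : Fin n, 1 ≤ (i : ℕ) ∧ (i : ℕ) < k ∧ a = γ i} ∪
      {a | ∃ i : Fin n, k ≤ (i : ℕ) ∧ a = lam i} ∪
      {a | ∃ i : Fin n, k ≤ (i : ℕ) ∧ a = ρ i} : Set (MulAut (FreeGroup (Fin n)))),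
      a (FreeGroup.of ⟨0, by omega⟩) = FreeGroup.of ⟨0, by omega⟩ ∧
      ∀ j, ∃ p q : ℤ, a (FreeGroup.of j) =
        FreeGroup.of ⟨0, by omega⟩ ^ p * FreeGroup.of j * FreeGroup.of ⟨0, by omega⟩ ^ q := by
    have ne_zero : ∀ i : Fin n, 1 ≤ (i : ℕ) → (⟨0, by omega⟩ : Fin n) ≠ i := by
      rintro i hi rfl
      simp at hi
    rintro a ((⟨i, hi, hik, rfl⟩ | ⟨i, hi, rfl⟩) | ⟨i, hi, rfl⟩)
    · obtain ⟨h, h'⟩ := hγ i hi hik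
      exact ⟨h' _ (ne_zero i hi),
        FreeGroup.exists_zpow_mul_mul_zpow (-1) 1 (by simpa using h) h'⟩
    · obtain ⟨h, h'⟩ := hlam i hi
      exact ⟨h' _ (ne_zero i (hk1.trans hi)),
        FreeGroup.exists_zpow_mul_mul_zpow 1 0 (by simpa using h) h'⟩
    · obtain ⟨h, h'⟩ := hρ i hi
      exact ⟨h' _ (ne_zero i (hk1.trans hi)),
        FreeGroup.exists_zpow_mul_mul_zpow 0 1 (by simpa using h) h'⟩
  intro a ha b hb _
  exact FreeGroup.commute_of_zpow_mul_of_mul_zpow (key a ha).1 (key b hb).1 (key a ha).2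
    (key b hb).2
end

section
/- Let n ≥ 2 and 1 ≤ k ≤ n. The group homomorphism from the free abelian group of rank 2n−k−1 (e.g. Multiplicative (Fin (2n−k−1) →₀ ℤ)) to Aut(F_n) sending the standard basis elements to the automorphisms γ_i (2 ≤ i ≤ k), λ_i and ρ_i (k < i ≤ n) is injective; in particular these automorphisms generate a free abelian subgroup of Aut(F_n) of rank 2n−k−1. -/
/-- In a free group, left and right multiplication of a generator by powers of another generator
is a free action of `ℤ × ℤ`. -/
lemma FreeGroup.zpow_mul_of_mul_zpow_eq_of {α : Type*} {a b : α} (hab : b ≠ a) {p q : ℤ}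
    (h : (FreeGroup.of a) ^ p * FreeGroup.of b * (FreeGroup.of a) ^ q = FreeGroup.of b) :
    p = 0 ∧ q = 0 := by
  classical
  let s : Equiv.Perm ℤ := Equiv.addRight 1
  let t : Equiv.Perm ℤ := Equiv.swap 0 1
  have key : s ^ p * t * s ^ q = t := by
    simpa [hab] using congrArg (FreeGroup.lift fun i => if i = a then s else t) h
  have hs (m x : ℤ) : (s ^ m) x = x + m := by
    induction m generalizing x with
    | zero => simp
    | succ m ih => rw [zpow_add_one, Equiv.Perm.mul_apply, ih]; simp [s]; ring
    | pred m ih => rw [zpow_sub_one, Equiv.Perm.mul_apply, ih]; simp [s]; ring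
  have ev (x : ℤ) : t (x + q) + p = t x := by
    simpa [hs] using congrArg (fun e : Equiv.Perm ℤ => e x) key
  have h1 := ev (|q| + 2)
  have h2 := ev 0
  have h3 := neg_abs_le q
  have h4 := abs_nonneg q
  simp only [t, Equiv.swap_apply_def] at h1 h2
  split_ifs at h1 h2 <;> omega

namespace FreeGroup

variable {n : ℕ}

/-- The automorphism `φ` fixes the generator `z` and sends every generator `x_i` to
`z ^ p i * x_i * z ^ q i`. -/
def IsTwoSidedTransvection (z : Fin n) (φ : MulAut (FreeGroup (Fin n))) (p q : Fin n → ℤ) : Prop :=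
  φ (of z) = of z ∧ ∀ i, φ (of i) = of z ^ p i * of i * of z ^ q i

namespace IsTwoSidedTransvection

variable {z : Fin n} {φ ψ : MulAut (FreeGroup (Fin n))} {p q p' q' : Fin n → ℤ}

lemma one : IsTwoSidedTransvection z 1 0 0 := by
  simp [IsTwoSidedTransvection]

lemma mul (hφ : IsTwoSidedTransvection z φ p q) (hψ : IsTwoSidedTransvection z ψ p' q') :
    IsTwoSidedTransvection z (φ * ψ) (p + p') (q + q') := by
  refine ⟨by simp [hψ.1, hφ.1], fun i => ?_⟩
  rw [MulAut.mul_apply, hψ.2, _root_.map_mul, _root_.map_mul, map_zpow, map_zpow, hφ.1, hφ.2, Pi.add_apply,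
    Pi.add_apply, add_comm (p i), zpow_add, zpow_add]
  simp only [mul_assoc]

lemma inv (hφ : IsTwoSidedTransvection z φ p q) :
    IsTwoSidedTransvection z φ⁻¹ (-p) (-q) := by
  refine ⟨φ.injective ?_, fun i => φ.injective ?_⟩
  · rw [MulAut.apply_inv_self, hφ.1]
  · rw [MulAut.apply_inv_self, _root_.map_mul, _root_.map_mul, map_zpow, map_zpow, hφ.1, hφ.2]
    simp [mul_assoc]

lemma eq_zero (h : IsTwoSidedTransvection z 1 p q) {i : Fin n} (hi : i ≠ z) :
    p i = 0 ∧ q i = 0 :=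
  zpow_mul_of_mul_zpow_eq_of hi (h.2 i).symm

/-- If a homomorphism from a free abelian group sends the basis to transvections with exponents
given by additive maps, it sends every element to such a transvection. -/
lemma of_basis {ι : Type*} (f : Multiplicative (ι →₀ ℤ) →* MulAut (FreeGroup (Fin n)))
    (P Q : (ι →₀ ℤ) →+ (Fin n → ℤ))
    (h : ∀ j, IsTwoSidedTransvection z (f (Multiplicative.ofAdd (Finsupp.single j 1)))
      (P (Finsupp.single j 1)) (Q (Finsupp.single j 1))) (a : ι →₀ ℤ) :
    IsTwoSidedTransvection z (f (Multiplicative.ofAdd a)) (P a) (Q a) := by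
  let H : AddSubgroup (ι →₀ ℤ) :=
    { carrier := {a | IsTwoSidedTransvection z (f (Multiplicative.ofAdd a)) (P a) (Q a)}
      zero_mem' := by simpa using one
      add_mem' := fun ha hb => by simpa using ha.mul hb
      neg_mem' := fun ha => by simpa using ha.inv }
  change a ∈ H
  induction a using Finsupp.induction_linear with
  | zero => exact H.zero_mem
  | add a b ha hb => exact H.add_mem ha hb
  | single j m => simpa using H.zsmul_mem (show Finsupp.single j 1 ∈ H from h j) m

end IsTwoSidedTransvection

end FreeGroup

/-- Let `n ≥ 2` and `1 ≤ k ≤ n`.  The group homomorphism from the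
free abelian group of rank `2n-k-1` (realized as `Multiplicative (Fin (2n-k-1) →₀ ℤ)`)
to `Aut(F_n)` sending the standard basis elements to the automorphisms `γ_i`
(`2 ≤ i ≤ k`), `λ_i` and `ρ_i` (`k < i ≤ n`) is injective; in particular these
automorphisms generate a free abelian subgroup of `Aut(F_n)` of rank `2n-k-1`.
Generators `x_1, …, x_n` are indexed by `Fin n` (`x_i ↔ ⟨i-1, _⟩`).  The basis
element of index `j` is sent to `γ_{j+2}` for `j < k-1`, to `λ` of generator-index
`j+1` for `k-1 ≤ j < n-1`, and to `ρ` of generator-index `j-(n-1)+k` otherwise. -/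
theorem partially_symmetric_free_abelian_aut
    (n k : ℕ) (hn : 2 ≤ n) (hk1 : 1 ≤ k) (hkn : k ≤ n)
    (γ lam ρ : Fin n → MulAut (FreeGroup (Fin n)))
    (hγ : ∀ i : Fin n, 1 ≤ (i : ℕ) → (i : ℕ) < k →
      γ i (FreeGroup.of i) =
        (FreeGroup.of (⟨0, by omega⟩ : Fin n))⁻¹ * FreeGroup.of i *
          FreeGroup.of (⟨0, by omega⟩ : Fin n) ∧
      ∀ j : Fin n, j ≠ i → γ i (FreeGroup.of j) = FreeGroup.of j)
    (hlam : ∀ i : Fin n, k ≤ (i : ℕ) →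
      lam i (FreeGroup.of i) = FreeGroup.of (⟨0, by omega⟩ : Fin n) * FreeGroup.of i ∧
      ∀ j : Fin n, j ≠ i → lam i (FreeGroup.of j) = FreeGroup.of j)
    (hρ : ∀ i : Fin n, k ≤ (i : ℕ) →
      ρ i (FreeGroup.of i) = FreeGroup.of i * FreeGroup.of (⟨0, by omega⟩ : Fin n) ∧
      ∀ j : Fin n, j ≠ i → ρ i (FreeGroup.of j) = FreeGroup.of j)
    (f : Multiplicative (Fin (2 * n - k - 1) →₀ ℤ) →* MulAut (FreeGroup (Fin n)))
    (hf : ∀ j : Fin (2 * n - k - 1),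
      f (Multiplicative.ofAdd (Finsupp.single j 1)) =
        if h1 : (j : ℕ) < k - 1 then γ ⟨(j : ℕ) + 1, by omega⟩
        else if h2 : (j : ℕ) < n - 1 then lam ⟨(j : ℕ) + 1, by omega⟩
        else ρ ⟨(j : ℕ) - (n - 1) + k, by have := j.isLt; omega⟩) :
    Function.Injective f := by
  classical
  let z : Fin n := ⟨0, by omega⟩
  let P : (Fin (2 * n - k - 1) →₀ ℤ) →+ (Fin n → ℤ) :=
    { toFun := fun a i => if (i : ℕ) = 0 then 0 else
        if (i : ℕ) < k then -a ⟨i - 1, by omega⟩ else a ⟨i - 1, by omega⟩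
      map_zero' := by ext i; simp
      map_add' := fun a b => by
        ext i
        simp only [Finsupp.add_apply, Pi.add_apply]
        split_ifs <;> ring }
  let Q : (Fin (2 * n - k - 1) →₀ ℤ) →+ (Fin n → ℤ) :=
    { toFun := fun a i => if (i : ℕ) = 0 then 0 else
        if h : (i : ℕ) < k then a ⟨i - 1, by omega⟩ else a ⟨i - k + (n - 1), by omega⟩
      map_zero' := by ext i; simp
      map_add' := fun a b => by
        ext i
        simp only [Finsupp.add_apply, Pi.add_apply]
        split_ifs <;> ring }
  have basis := FreeGroup.IsTwoSidedTransvection.of_basis (z := z) f P Q <| by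
    intro j
    have hj := j.isLt
    rw [hf j]
    split_ifs with h1 h2
    · obtain ⟨e1, e2⟩ := hγ ⟨j + 1, by omega⟩ (by simp) (by simp; omega)
      refine ⟨e2 _ (by simp [z]), fun i => ?_⟩
      by_cases hi : i = ⟨j + 1, by omega⟩
      · subst hi
        have : (j : ℕ) + 1 < k := by omega
        simp [e1, P, Q, z, this]
      · rw [e2 i hi]
        have hi' : (i : ℕ) ≠ j + 1 := fun h => hi (Fin.ext h)
        have c1 : (i : ℕ) ≠ 0 → (j : ℕ) ≠ i - 1 := by omega
        have c2 : (j : ℕ) ≠ i - k + (n - 1) := by omega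
        by_cases h0 : (i : ℕ) = 0 <;>
          simp_all [P, Q, Fin.ext_iff]
    · obtain ⟨e1, e2⟩ := hlam ⟨j + 1, by omega⟩ (by simp; omega)
      refine ⟨e2 _ (by simp [z]), fun i => ?_⟩
      by_cases hi : i = ⟨j + 1, by omega⟩
      · subst hi
        have c1 : ¬ (j : ℕ) + 1 < k := by omega
        have c2 : (j : ℕ) ≠ j + 1 - k + (n - 1) := by omega
        simp [e1, P, Q, z, c1, c2, Fin.ext_iff]
      · rw [e2 i hi]
        have hi' : (i : ℕ) ≠ j + 1 := fun h => hi (Fin.ext h)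
        have c1 : (i : ℕ) ≠ 0 → (j : ℕ) ≠ i - 1 := by omega
        have c2 : (j : ℕ) ≠ i - k + (n - 1) := by omega
        by_cases h0 : (i : ℕ) = 0 <;>
          simp_all [P, Q, Fin.ext_iff]
    · obtain ⟨e1, e2⟩ := hρ ⟨j - (n - 1) + k, by omega⟩ (by simp)
      refine ⟨e2 _ (by simp [z, Fin.ext_iff]; omega), fun i => ?_⟩
      by_cases hi : i = ⟨j - (n - 1) + k, by omega⟩
      · subst hi
        have c0 : k ≠ 0 := by omega
        have c1 : (j : ℕ) ≠ j - (n - 1) + k - 1 := by omega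
        have c2 : (j : ℕ) = j - (n - 1) + (n - 1) := by omega
        simp [e1, P, Q, z, c0, c1, ← c2, Fin.ext_iff]
      · rw [e2 i hi]
        have hi' : (i : ℕ) ≠ j - (n - 1) + k := fun h => hi (Fin.ext h)
        have c1 : (j : ℕ) ≠ i - 1 := by omega
        have c2 : ¬ (i : ℕ) < k → (j : ℕ) ≠ i - k + (n - 1) := by omega
        by_cases h0 : (i : ℕ) < k <;>
          simp_all [P, Q, Fin.ext_iff]
  rw [injective_iff_map_eq_one]
  intro a ha
  have hb := basis a.toAdd
  rw [ofAdd_toAdd, ha] at hb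
  apply Multiplicative.toAdd.injective
  ext j
  have hj := j.isLt
  by_cases h2 : (j : ℕ) < n - 1
  · have h := (hb.eq_zero (i := ⟨j + 1, by omega⟩) (by simp [z])).1
    simp only [P, AddMonoidHom.coe_mk, ZeroHom.coe_mk] at h
    split_ifs at h <;> simp_all
  · have h := (hb.eq_zero (i := ⟨j - (n - 1) + k, by omega⟩)
      (by simp [z, Fin.ext_iff]; omega)).2
    have c0 : k ≠ 0 := by omega
    have c2 : (j : ℕ) - (n - 1) + (n - 1) = j := by omega
    simpa [Q, c0, c2] using h
end

section
/- Let n ≥ 2 and 1 ≤ k ≤ n. The inner automorphism of F_n given by w ↦ x_1⁻¹ w x_1 equals the composition (in any order, since the factors commute) of the automorphisms γ_2, …, γ_k and λ_i⁻¹ ∘ ρ_i for k < i ≤ n. In particular, this inner automorphism lies in the subgroup of Aut(F_n) generated by the γ_i, λ_i, ρ_i. -/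
/-- An automorphism of a free group is determined by its values on the generators. -/
theorem FreeGroup.mulAut_ext {α : Type*} {f g : MulAut (FreeGroup α)}
    (h : ∀ j, f (FreeGroup.of j) = g (FreeGroup.of j)) : f = g := by
  have key : f.toMonoidHom = g.toMonoidHom := FreeGroup.ext_hom _ _ h
  exact MulEquiv.ext fun x => DFunLike.congr_fun key x

/-- If `φ i` conjugates the generator `i` by the generator `a` and fixes the other generators,
then the product of the `φ i` over a list without repetition conjugates exactly the generators
in the list. -/
theorem FreeGroup.list_prod_partial_conj_apply {α : Type*} [DecidableEq α] (a : α)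
    (φ : α → MulAut (FreeGroup α))
    (hself : ∀ i, φ i (FreeGroup.of i) =
      (FreeGroup.of a)⁻¹ * FreeGroup.of i * FreeGroup.of a)
    (hne : ∀ i j, j ≠ i → φ i (FreeGroup.of j) = FreeGroup.of j)
    (l : List α) (hl : l.Nodup) (j : α) :
    (l.map φ).prod (FreeGroup.of j) =
      if j ∈ l then (FreeGroup.of a)⁻¹ * FreeGroup.of j * FreeGroup.of a
      else FreeGroup.of j := by
  have hfix : ∀ i, φ i (FreeGroup.of a) = FreeGroup.of a := by
    intro i
    by_cases h : a = i
    · subst h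
      simp [hself]
    · exact hne i a h
  induction l with
  | nil => simp
  | cons i l ih =>
    obtain ⟨hi, hl⟩ := List.nodup_cons.mp hl
    rw [List.map_cons, List.prod_cons, MulAut.mul_apply, ih hl]
    by_cases hji : j = i
    · subst hji
      simp [hi, hself]
    · by_cases hjl : j ∈ l
      · simp [hjl, hfix, hne i j hji]
      · simp [hjl, hji, hne i j hji]

/-- Let `n ≥ 2` and `1 ≤ k ≤ n`.  The inner automorphism of `F_n`
given by `w ↦ x_1⁻¹ w x_1` (i.e. conjugation by `x_1⁻¹`) equals the composition
(in any order, since the factors commute; here taken in the order of increasing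
index) of the automorphisms `γ_2, …, γ_k` and `λ_i⁻¹ ∘ ρ_i` for `k < i ≤ n`.
In particular, this inner automorphism lies in the subgroup of `Aut(F_n)`
generated by the `γ_i`, `λ_i`, `ρ_i`.  Generators `x_1, …, x_n` are indexed by
`Fin n` (`x_i ↔ ⟨i-1, _⟩`). -/
theorem inner_conj_x1_eq_product
    (n k : ℕ) (hn : 2 ≤ n) (hk1 : 1 ≤ k) (hkn : k ≤ n)
    (γ lam ρ : Fin n → MulAut (FreeGroup (Fin n)))
    (hγ : ∀ i : Fin n, 1 ≤ (i : ℕ) → (i : ℕ) < k →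
      γ i (FreeGroup.of i) =
        (FreeGroup.of (⟨0, by omega⟩ : Fin n))⁻¹ * FreeGroup.of i *
          FreeGroup.of (⟨0, by omega⟩ : Fin n) ∧
      ∀ j : Fin n, j ≠ i → γ i (FreeGroup.of j) = FreeGroup.of j)
    (hlam : ∀ i : Fin n, k ≤ (i : ℕ) →
      lam i (FreeGroup.of i) = FreeGroup.of (⟨0, by omega⟩ : Fin n) * FreeGroup.of i ∧
      ∀ j : Fin n, j ≠ i → lam i (FreeGroup.of j) = FreeGroup.of j)
    (hρ : ∀ i : Fin n, k ≤ (i : ℕ) →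
      ρ i (FreeGroup.of i) = FreeGroup.of i * FreeGroup.of (⟨0, by omega⟩ : Fin n) ∧
      ∀ j : Fin n, j ≠ i → ρ i (FreeGroup.of j) = FreeGroup.of j) :
    MulAut.conj ((FreeGroup.of (⟨0, by omega⟩ : Fin n))⁻¹) =
      (List.ofFn (fun i : Fin n =>
        if (i : ℕ) = 0 then 1
        else if (i : ℕ) < k then γ i
        else (lam i)⁻¹ * ρ i)).prod ∧
    MulAut.conj ((FreeGroup.of (⟨0, by omega⟩ : Fin n))⁻¹) ∈
      Subgroup.closure
        ({a | ∃ i : Fin n, 1 ≤ (i : ℕ) ∧ (i : ℕ) < k ∧ a = γ i} ∪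
         {a | ∃ i : Fin n, k ≤ (i : ℕ) ∧ a = lam i} ∪
         {a | ∃ i : Fin n, k ≤ (i : ℕ) ∧ a = ρ i}) := by
  have hpos : ∀ i : Fin n, k ≤ (i : ℕ) → (⟨0, by omega⟩ : Fin n) ≠ i := by
    intro i hi h
    have := congrArg Fin.val h
    simp only at this
    omega
  have hprod : MulAut.conj ((FreeGroup.of (⟨0, by omega⟩ : Fin n))⁻¹) =
      (List.ofFn (fun i : Fin n =>
        if (i : ℕ) = 0 then 1
        else if (i : ℕ) < k then γ i
        else (lam i)⁻¹ * ρ i)).prod := by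
    refine FreeGroup.mulAut_ext fun j => ?_
    rw [List.ofFn_eq_map, FreeGroup.list_prod_partial_conj_apply (⟨0, by omega⟩ : Fin n) _ ?_ ?_ _
      (List.nodup_finRange n) j]
    · simp
    · intro i
      split_ifs with h0 h1
      · have hi : i = ⟨0, by omega⟩ := Fin.ext h0
        rw [hi]
        simp
      · exact (hγ i (by omega) h1).1
      · have hi : k ≤ (i : ℕ) := by omega
        rw [MulAut.mul_apply, (hρ i hi).1, MulAut.inv_apply, MulEquiv.symm_apply_eq]
        simp [(hlam i hi).1, (hlam i hi).2 _ (hpos i hi)]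
    · intro i j hj
      split_ifs with h0 h1
      · rfl
      · exact (hγ i (by omega) h1).2 j hj
      · have hi : k ≤ (i : ℕ) := by omega
        rw [MulAut.mul_apply, (hρ i hi).2 j hj, MulAut.inv_apply, MulEquiv.symm_apply_eq,
          (hlam i hi).2 j hj]
  refine ⟨hprod, ?_⟩
  rw [hprod]
  refine Subgroup.list_prod_mem _ fun x hx => ?_
  obtain ⟨i, rfl⟩ := (List.mem_ofFn' _ _).mp hx
  dsimp only
  split_ifs with h0 h1
  · exact one_mem _
  · exact Subgroup.subset_closure (Or.inl (Or.inl ⟨i, by omega, h1, rfl⟩))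
  · have hi : k ≤ (i : ℕ) := by omega
    exact mul_mem (inv_mem (Subgroup.subset_closure (Or.inl (Or.inr ⟨i, hi, rfl⟩))))
      (Subgroup.subset_closure (Or.inr ⟨i, hi, rfl⟩))
end

section
/- Let n ≥ 2 and 1 ≤ k ≤ n. Then PΣ(n,k) contains a free abelian subgroup of rank 2n−k−2: there is an injective group homomorphism from the free abelian group of rank 2n−k−2 into Out(F_n) whose image is contained in PΣ(n,k), obtained from the classes of the automorphisms γ_i (2 ≤ i ≤ k), λ_i, ρ_i (k < i ≤ n). (This is the lower-bound half of the theorem that PΣ(n,k) has virtual cohomological dimension 2n−k−2.) -/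
/-- The subgroup of inner automorphisms is normal in the automorphism group. -/
instance innerAutNormal (G : Type*) [Group G] :
    ((MulAut.conj : G →* MulAut G).range).Normal := by
  constructor
  intro x hx φ
  obtain ⟨g, rfl⟩ := hx
  refine ⟨φ g, ?_⟩
  ext y
  simp [MulAut.conj]

/-- The outer automorphism group of a group `G`: the quotient of `Aut(G)` by
the normal subgroup of inner automorphisms. -/
abbrev OutG (G : Type*) [Group G] : Type _ :=
  MulAut G ⧸ ((MulAut.conj : G →* MulAut G).range)

/-- The canonical projection `Aut(G) → Out(G)`. -/
def outMk (G : Type*) [Group G] : MulAut G →* OutG G :=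
  QuotientGroup.mk' _

namespace FreeGroup

variable {α : Type*}

theorem mulAut_ext_s3 {φ ψ : MulAut (FreeGroup α)} (h : ∀ i, φ (of i) = ψ (of i)) : φ = ψ :=
  MulEquiv.ext fun x =>
    DFunLike.congr_fun (FreeGroup.ext_hom (φ : FreeGroup α →* FreeGroup α) ψ h) x

variable [DecidableEq α]

/-- The endomorphism fixing `x_z` and sending `x_i` to `x_z ^ a i * x_i * x_z ^ b i` for
`i ≠ z`. -/
def twoSidedEnd (z : α) (a b : α → ℤ) : FreeGroup α →* FreeGroup α :=
  lift fun i => if i = z then of z else of z ^ a i * of i * of z ^ b i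

theorem twoSidedEnd_of_self (z : α) (a b : α → ℤ) : twoSidedEnd z a b (of z) = of z := by
  simp [twoSidedEnd]

theorem twoSidedEnd_of_ne {z i : α} (h : i ≠ z) (a b : α → ℤ) :
    twoSidedEnd z a b (of i) = of z ^ a i * of i * of z ^ b i := by
  simp [twoSidedEnd, h]

theorem twoSidedEnd_comp (z : α) (a b a' b' : α → ℤ) :
    (twoSidedEnd z a b).comp (twoSidedEnd z a' b') = twoSidedEnd z (a + a') (b + b') := by
  ext i
  by_cases h : i = z
  · subst h
    simp [twoSidedEnd_of_self]
  · rw [MonoidHom.comp_apply, twoSidedEnd_of_ne h, twoSidedEnd_of_ne h, Pi.add_apply,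
      Pi.add_apply, add_comm (a i), zpow_add, zpow_add]
    simp only [_root_.map_mul, _root_.map_zpow, twoSidedEnd_of_self, twoSidedEnd_of_ne h,
      mul_assoc]

theorem twoSidedEnd_zero (z : α) : twoSidedEnd z 0 0 = MonoidHom.id (FreeGroup α) := by
  ext i
  by_cases h : i = z
  · subst h
    simp [twoSidedEnd_of_self]
  · simp [twoSidedEnd_of_ne h]

/-- The automorphisms `x_i ↦ x_z ^ a i * x_i * x_z ^ b i`, as a homomorphism in the pair of
exponent vectors `(a, b)`. -/
def twoSidedAut (z : α) : Multiplicative ((α → ℤ) × (α → ℤ)) →* MulAut (FreeGroup α) where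
  toFun p := (twoSidedEnd z p.toAdd.1 p.toAdd.2).toMulEquiv
    (twoSidedEnd z (-p.toAdd.1) (-p.toAdd.2))
    (by rw [twoSidedEnd_comp, neg_add_cancel, neg_add_cancel, twoSidedEnd_zero])
    (by rw [twoSidedEnd_comp, add_neg_cancel, add_neg_cancel, twoSidedEnd_zero])
  map_one' := MulEquiv.ext fun x => DFunLike.congr_fun (twoSidedEnd_zero z) x
  map_mul' p q := MulEquiv.ext fun x =>
    (DFunLike.congr_fun (twoSidedEnd_comp z p.toAdd.1 p.toAdd.2 q.toAdd.1 q.toAdd.2) x).symm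

theorem twoSidedAut_of_self (z : α) (p : Multiplicative ((α → ℤ) × (α → ℤ))) :
    twoSidedAut z p (of z) = of z :=
  twoSidedEnd_of_self z _ _

theorem twoSidedAut_of_ne {z i : α} (h : i ≠ z) (p : Multiplicative ((α → ℤ) × (α → ℤ))) :
    twoSidedAut z p (of i) = of z ^ p.toAdd.1 i * of i * of z ^ p.toAdd.2 i :=
  twoSidedEnd_of_ne h _ _

end FreeGroup

open Matrix in
/-- If `g ∈ SL(2, ℤ)` commutes with `T = !![1, 1; 0, 1]` and conjugates `U = !![1, 0; 1, 1]` to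
`T ^ a * U * T ^ b`, then `a` and `b` are determined by `g`. -/
theorem exponents_eq_of_conj_transvection {g : Matrix (Fin 2) (Fin 2) ℤ} (hdet : g.det = 1)
    (hT : g * !![1, 1; 0, 1] = !![1, 1; 0, 1] * g) {a b : ℤ}
    (hU : g * !![1, 0; 1, 1] = !![1, a; 0, 1] * !![1, 0; 1, 1] * !![1, b; 0, 1] * g) :
    g 0 0 ≠ 0 ∧ g 0 1 = a * g 0 0 ∧ g 0 1 = -b * g 0 0 := by
  rw [det_fin_two] at hdet
  rw [← Matrix.ext_iff] at hT hU
  simp [Fin.forall_fin_two, Matrix.mul_apply, Fin.sum_univ_two] at hT hU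
  obtain ⟨⟨h1, h2⟩, h3⟩ := hT
  obtain ⟨⟨u1, u2⟩, u3, u4⟩ := hU
  have h10 : g 1 0 = 0 := by grind
  have h11 : g 1 1 = g 0 0 := by grind
  refine ⟨?_, ?_, ?_⟩
  · rintro h
    simp [h, h10] at hdet
  · grind
  · grind

open FreeGroup in
/-- If `x_i ↦ x_z ^ a i * x_i * x_z ^ b i` is inner and `b l = 0` for some `l ≠ z`, then all
exponents vanish. -/
theorem exponents_eq_zero_of_twoSidedAut_eq_conj {α : Type*} [DecidableEq α] {z l : α}
    (hl : l ≠ z) {p : Multiplicative ((α → ℤ) × (α → ℤ))} {g : FreeGroup α}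
    (hg : MulAut.conj g = twoSidedAut z p) (hp : p.toAdd.2 l = 0) {i : α} (hi : i ≠ z) :
    p.toAdd.1 i = 0 ∧ p.toAdd.2 i = 0 := by
  let T : Matrix.SpecialLinearGroup (Fin 2) ℤ := ModularGroup.T
  let U : Matrix.SpecialLinearGroup (Fin 2) ℤ := ⟨!![1, 0; 1, 1], by simp⟩
  let f : FreeGroup α →* Matrix.SpecialLinearGroup (Fin 2) ℤ :=
    lift fun j => if j = z then T else U
  have hfz : f (of z) = T := by simp [f]
  have hT : f g * T = T * f g := by
    have h := congrArg f (DFunLike.congr_fun hg (of z))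
    rw [twoSidedAut_of_self, MulAut.conj_apply, _root_.map_mul, _root_.map_mul, _root_.map_inv, hfz] at h
    exact mul_inv_eq_iff_eq_mul.mp h
  have hU {j : α} (hj : j ≠ z) :
      f g * U = T ^ p.toAdd.1 j * U * T ^ p.toAdd.2 j * f g := by
    have hfj : f (of j) = U := by simp [f, hj]
    have h := congrArg f (DFunLike.congr_fun hg (of j))
    simp only [twoSidedAut_of_ne hj, MulAut.conj_apply, _root_.map_mul, _root_.map_inv, _root_.map_zpow, hfz,
      hfj] at h
    exact mul_inv_eq_iff_eq_mul.mp h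
  have key {j : α} (hj : j ≠ z) := exponents_eq_of_conj_transvection (f g).det_coe
    (congrArg Subtype.val hT) (a := p.toAdd.1 j) (b := p.toAdd.2 j) (by
      rw [← ModularGroup.coe_T_zpow, ← ModularGroup.coe_T_zpow]
      exact congrArg Subtype.val (hU hj))
  obtain ⟨h0, -, h2⟩ := key hl
  obtain ⟨-, h3, h4⟩ := key hi
  rw [h2, hp] at h3 h4
  simp_all

/-- The `m`-th coordinate of an integer vector extended by zero, as an additive homomorphism. -/
noncomputable def extendCoord {r : ℕ} (m : ℕ) : (Fin r →₀ ℤ) →+ ℤ where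
  toFun v := if h : m < r then v ⟨m, h⟩ else 0
  map_zero' := by simp
  map_add' v w := by split <;> simp

theorem extendCoord_single {r : ℕ} (m : ℕ) (j : Fin r) :
    extendCoord m (Finsupp.single j 1) = if m = j then 1 else 0 := by
  by_cases h : m < r
  · simp [extendCoord, h, Finsupp.single_apply, Fin.ext_iff, eq_comm]
  · have : m ≠ j := by omega
    simp [extendCoord, h, this]

/-- The exponent vectors `(a, b)` of the automorphism attached to an integer vector: its first
`n - 1` coordinates are the exponents of `γ_i` and `λ_i`, the others those of `ρ_i`.
The generator `ρ_n` (`γ_n` when `k = n`) is omitted. -/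
noncomputable def exponentHom (n k : ℕ) :
    (Fin (2 * n - k - 2) →₀ ℤ) →+ (Fin n → ℤ) × (Fin n → ℤ) :=
  AddMonoidHom.prod
    (AddMonoidHom.pi fun i : Fin n =>
      if (i : ℕ) < k then -extendCoord ((i : ℕ) - 1) else extendCoord ((i : ℕ) - 1))
    (AddMonoidHom.pi fun i : Fin n =>
      if (i : ℕ) < k then extendCoord ((i : ℕ) - 1) else extendCoord ((i : ℕ) - k + (n - 1)))

theorem exponentHom_fst (n k : ℕ) (v : Fin (2 * n - k - 2) →₀ ℤ) (i : Fin n) :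
    (exponentHom n k v).1 i =
      if (i : ℕ) < k then -extendCoord ((i : ℕ) - 1) v else extendCoord ((i : ℕ) - 1) v := by
  simp only [exponentHom, AddMonoidHom.prod_apply, AddMonoidHom.pi_apply]
  split <;> rfl

theorem exponentHom_snd (n k : ℕ) (v : Fin (2 * n - k - 2) →₀ ℤ) (i : Fin n) :
    (exponentHom n k v).2 i =
      if (i : ℕ) < k then extendCoord ((i : ℕ) - 1) v
      else extendCoord ((i : ℕ) - k + (n - 1)) v := by
  simp only [exponentHom, AddMonoidHom.prod_apply, AddMonoidHom.pi_apply]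
  split <;> rfl

theorem exponentHom_snd_last {n k : ℕ} (hn : 2 ≤ n) (hkn : k ≤ n)
    (v : Fin (2 * n - k - 2) →₀ ℤ) : (exponentHom n k v).2 ⟨n - 1, by omega⟩ = 0 := by
  rw [exponentHom_snd]
  dsimp only
  split <;> exact dif_neg (by omega)

theorem eq_zero_of_exponentHom {n k : ℕ} (hk1 : 1 ≤ k)
    {v : Fin (2 * n - k - 2) →₀ ℤ}
    (h : ∀ i : Fin n, 1 ≤ (i : ℕ) → (exponentHom n k v).1 i = 0 ∧ (exponentHom n k v).2 i = 0) :
    v = 0 := by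
  ext j
  have hj : extendCoord (j : ℕ) v = v j := dif_pos j.isLt
  rw [← hj, Finsupp.zero_apply]
  by_cases hjn : (j : ℕ) < n - 1
  · have h1 := (h ⟨j + 1, by omega⟩ (by simp)).1
    rw [exponentHom_fst] at h1
    simp only [Nat.add_sub_cancel] at h1
    split at h1 <;> simpa using h1
  · have h1 := (h ⟨j - (n - 1) + k, by omega⟩ (by simp; omega)).2
    rw [exponentHom_snd, if_neg (by simp)] at h1
    convert h1 using 2
    dsimp only
    congr 1
    omega

open FreeGroup in
/-- The automorphism attached to a basis vector is one of the `γ_i`, `λ_i`, `ρ_i`. -/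
theorem twoSidedAut_exponentHom_single_mem {n k : ℕ} (hk1 : 1 ≤ k) {z : Fin n}
    (hz : (z : ℕ) = 0)
    (γ lam ρ : Fin n → MulAut (FreeGroup (Fin n)))
    (hγ : ∀ i : Fin n, 1 ≤ (i : ℕ) → (i : ℕ) < k →
      γ i (of i) = (of z)⁻¹ * of i * of z ∧
      ∀ j : Fin n, j ≠ i → γ i (of j) = of j)
    (hlam : ∀ i : Fin n, k ≤ (i : ℕ) →
      lam i (of i) = of z * of i ∧
      ∀ j : Fin n, j ≠ i → lam i (of j) = of j)
    (hρ : ∀ i : Fin n, k ≤ (i : ℕ) →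
      ρ i (of i) = of i * of z ∧
      ∀ j : Fin n, j ≠ i → ρ i (of j) = of j) (j : Fin (2 * n - k - 2)) :
    twoSidedAut z
        (Multiplicative.ofAdd (exponentHom n k (Finsupp.single j 1))) ∈
      ({a | ∃ i : Fin n, 1 ≤ (i : ℕ) ∧ (i : ℕ) < k ∧ a = γ i} ∪
         {a | ∃ i : Fin n, k ≤ (i : ℕ) ∧ a = lam i} ∪
         {a | ∃ i : Fin n, k ≤ (i : ℕ) ∧ a = ρ i}) := by
  have ext_of (φ : MulAut (FreeGroup (Fin n))) (i : Fin n) (hi : (i : ℕ) ≠ 0) (a b : ℤ)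
      (h1 : φ (of i) = of z ^ a * of i * of z ^ b)
      (h2 : ∀ j : Fin n, j ≠ i → φ (of j) = of j)
      (h3 : ∀ l : Fin n, (l : ℕ) ≠ 0 →
        (exponentHom n k (Finsupp.single j 1)).1 l = (if l = i then a else 0) ∧
        (exponentHom n k (Finsupp.single j 1)).2 l = (if l = i then b else 0)) :
      twoSidedAut z
        (Multiplicative.ofAdd (exponentHom n k (Finsupp.single j 1))) = φ := by
    refine mulAut_ext_s3 fun l => ?_
    by_cases hl : (l : ℕ) = 0
    · have hl' : l = z := Fin.ext (hl.trans hz.symm)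
      rw [h2 l (by rintro rfl; exact hi hl), hl', twoSidedAut_of_self]
    · rw [twoSidedAut_of_ne (by rintro rfl; exact hl hz), toAdd_ofAdd, (h3 l hl).1,
        (h3 l hl).2]
      by_cases hli : l = i
      · subst hli
        simp [h1]
      · simp [hli, h2 l hli]
  by_cases hjn : (j : ℕ) < n - 1
  · have hi : (j : ℕ) + 1 < n := by omega
    by_cases hjk : (j : ℕ) + 1 < k
    · obtain ⟨h1, h2⟩ := hγ ⟨j + 1, hi⟩ (by simp) hjk
      refine Or.inl (Or.inl ⟨_, by simp, hjk, ext_of _ ⟨j + 1, hi⟩ (by simp) (-1) 1 ?_ h2 ?_⟩)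
      · simpa using h1
      · intro l hl
        simp only [exponentHom_fst, exponentHom_snd, extendCoord_single, Fin.ext_iff]
        grind
    · obtain ⟨h1, h2⟩ := hlam ⟨j + 1, hi⟩ (not_lt.mp hjk)
      refine Or.inl (Or.inr ⟨_, not_lt.mp hjk, ext_of _ ⟨j + 1, hi⟩ (by simp) 1 0 ?_ h2 ?_⟩)
      · simpa using h1
      · intro l hl
        simp only [exponentHom_fst, exponentHom_snd, extendCoord_single, Fin.ext_iff]
        grind
  · have hi : (j : ℕ) - (n - 1) + k < n := by omega
    have hik : k ≤ (j : ℕ) - (n - 1) + k := by omega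
    obtain ⟨h1, h2⟩ := hρ ⟨j - (n - 1) + k, hi⟩ hik
    refine Or.inr ⟨_, hik, ext_of _ ⟨j - (n - 1) + k, hi⟩ (by simp; omega) 0 1 ?_ h2 ?_⟩
    · simpa using h1
    · intro l hl
      simp only [exponentHom_fst, exponentHom_snd, extendCoord_single, Fin.ext_iff]
      grind

/-- Let `n ≥ 2` and `1 ≤ k ≤ n`.  Then `PΣ(n,k)` contains a free
abelian subgroup of rank `2n-k-2`: there is an injective group homomorphism from
the free abelian group of rank `2n-k-2` into `Out(F_n)` whose image is contained
in `PΣ(n,k)` (the set of classes of automorphisms sending each of `x_1, …, x_k`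
to a conjugate of itself), and contained in the subgroup generated by the classes
of the automorphisms `γ_i` (`2 ≤ i ≤ k`), `λ_i`, `ρ_i` (`k < i ≤ n`).
Generators `x_1, …, x_n` are indexed by `Fin n` (`x_i ↔ ⟨i-1, _⟩`). -/
theorem PSigma_contains_free_abelian_of_rank
    (n k : ℕ) (hn : 2 ≤ n) (hk1 : 1 ≤ k) (hkn : k ≤ n)
    (γ lam ρ : Fin n → MulAut (FreeGroup (Fin n)))
    (hγ : ∀ i : Fin n, 1 ≤ (i : ℕ) → (i : ℕ) < k →
      γ i (FreeGroup.of i) =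
        (FreeGroup.of (⟨0, by omega⟩ : Fin n))⁻¹ * FreeGroup.of i *
          FreeGroup.of (⟨0, by omega⟩ : Fin n) ∧
      ∀ j : Fin n, j ≠ i → γ i (FreeGroup.of j) = FreeGroup.of j)
    (hlam : ∀ i : Fin n, k ≤ (i : ℕ) →
      lam i (FreeGroup.of i) = FreeGroup.of (⟨0, by omega⟩ : Fin n) * FreeGroup.of i ∧
      ∀ j : Fin n, j ≠ i → lam i (FreeGroup.of j) = FreeGroup.of j)
    (hρ : ∀ i : Fin n, k ≤ (i : ℕ) →
      ρ i (FreeGroup.of i) = FreeGroup.of i * FreeGroup.of (⟨0, by omega⟩ : Fin n) ∧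
      ∀ j : Fin n, j ≠ i → ρ i (FreeGroup.of j) = FreeGroup.of j) :
    ∃ F : Multiplicative (Fin (2 * n - k - 2) →₀ ℤ) →* OutG (FreeGroup (Fin n)),
      Function.Injective F ∧
      -- the image consists of classes of partially symmetric automorphisms, i.e.
      -- lies in PΣ(n,k)
      (∀ g, ∃ ψ : MulAut (FreeGroup (Fin n)),
        outMk (FreeGroup (Fin n)) ψ = F g ∧
        ∀ i : Fin n, (i : ℕ) < k → IsConj (FreeGroup.of i) (ψ (FreeGroup.of i))) ∧
      -- the image lies in the subgroup generated by the classes of the γ_i, λ_i, ρ_i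
      (∀ g, F g ∈ Subgroup.closure (outMk (FreeGroup (Fin n)) ''
        ({a | ∃ i : Fin n, 1 ≤ (i : ℕ) ∧ (i : ℕ) < k ∧ a = γ i} ∪
         {a | ∃ i : Fin n, k ≤ (i : ℕ) ∧ a = lam i} ∪
         {a | ∃ i : Fin n, k ≤ (i : ℕ) ∧ a = ρ i}))) := by
  let z : Fin n := ⟨0, by omega⟩
  let A : Multiplicative (Fin (2 * n - k - 2) →₀ ℤ) →* MulAut (FreeGroup (Fin n)) :=
    (FreeGroup.twoSidedAut z).comp (AddMonoidHom.toMultiplicative (exponentHom n k))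
  refine ⟨(outMk _).comp A, ?_, fun g => ⟨A g, rfl, fun i hi => ?_⟩, fun g => ?_⟩
  · rw [injective_iff_map_eq_one]
    intro v hv
    obtain ⟨g, hg⟩ := (QuotientGroup.eq_one_iff (A v)).mp hv
    refine eq_zero_of_exponentHom hk1 (v := v.toAdd) fun i hi => ?_
    exact exponents_eq_zero_of_twoSidedAut_eq_conj (l := ⟨n - 1, by omega⟩)
      (fun h => by have := congrArg Fin.val h; simp [z] at this; omega) hg
      (exponentHom_snd_last hn hkn _)
      (fun h => by have := congrArg Fin.val h; simp [z] at this; omega)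
  · by_cases hiz : i = z
    · rw [hiz, show A g (FreeGroup.of z) = FreeGroup.of z from
        FreeGroup.twoSidedAut_of_self z _]
    · rw [show A g (FreeGroup.of i) = _ from FreeGroup.twoSidedAut_of_ne hiz _,
        isConj_iff]
      refine ⟨FreeGroup.of z ^ (exponentHom n k g.toAdd).1 i, ?_⟩
      rw [← zpow_neg]
      congr 2
      simp only [AddMonoidHom.toMultiplicative_apply_apply, toAdd_ofAdd, exponentHom_fst,
        exponentHom_snd, if_pos hi, neg_neg]
  · induction g using Multiplicative.rec with | _ v
    induction v using Finsupp.induction_linear with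
    | zero => rw [ofAdd_zero, map_one]; exact one_mem _
    | add v w hv hw => rw [ofAdd_add, map_mul]; exact mul_mem hv hw
    | single j c =>
      rw [← Finsupp.smul_single_one, ofAdd_zsmul, map_zpow]
      exact zpow_mem (Subgroup.subset_closure (Set.mem_image_of_mem _
        (twoSidedAut_exponentHom_single_mem hk1 (z := z) rfl γ lam ρ hγ hlam hρ j))) c
end

section
/- Let Γ be a finite tree with e edges and ℓ leaves which has at least two vertices of degree ≥ 2 (i.e. Γ is not a star). Then Out(A_Γ) contains a free abelian subgroup of rank e + 2ℓ − 3. (This is the lower-bound half of the theorem that for a tree Γ, the virtual cohomological dimension of Out(A_Γ) equals e + 2ℓ − 3.) -/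
/-- The relators of a right-angled Artin group: commutators of adjacent generators. -/
def raagRels {V : Type*} (Γ : SimpleGraph V) : Set (FreeGroup V) :=
  {r | ∃ v w : V, Γ.Adj v w ∧
    r = FreeGroup.of v * FreeGroup.of w * (FreeGroup.of v)⁻¹ * (FreeGroup.of w)⁻¹}

/-- The right-angled Artin group of a simple graph. -/
abbrev RAAG {V : Type*} (Γ : SimpleGraph V) : Type _ := PresentedGroup (raagRels Γ)

/-- The generator of `RAAG Γ` corresponding to a vertex. -/
def raagGen {V : Type*} (Γ : SimpleGraph V) (v : V) : RAAG Γ := PresentedGroup.of v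

/-- `v` is a leaf: it has exactly one neighbor. -/
def IsLeaf {V : Type*} (Γ : SimpleGraph V) (v : V) : Prop :=
  (Γ.neighborSet v).ncard = 1

/-- The number of leaves. -/
noncomputable def numLeaves {V : Type*} (Γ : SimpleGraph V) : ℕ :=
  {v | IsLeaf Γ v}.ncard

/-- A subgraph has no separating vertex: deleting any of its vertices leaves it connected. -/
def NoCutVertex {V : Type*} {Γ : SimpleGraph V} (H : Γ.Subgraph) : Prop :=
  ∀ v ∈ H.verts, (H.deleteVerts {v}).Connected

/-- A piece (block) of `Γ`: a maximal connected subgraph with at least one edge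
having no separating vertex (a single edge counts as a piece). -/
def IsPiece {V : Type*} (Γ : SimpleGraph V) (H : Γ.Subgraph) : Prop :=
  H.Connected ∧ H.edgeSet.Nonempty ∧ NoCutVertex H ∧
    ∀ H' : Γ.Subgraph, H'.Connected → H'.edgeSet.Nonempty → NoCutVertex H' →
      H ≤ H' → H' = H

/-- The number of pieces of `Γ`. -/
noncomputable def numPieces {V : Type*} (Γ : SimpleGraph V) : ℕ :=
  Nat.card {H : Γ.Subgraph // IsPiece Γ H}

/-- `u` and `w` are connected by a walk in `Γ` avoiding the vertex `v`
(i.e. they lie in the same connected component of `Γ ∖ {v}`). -/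
def ReachAvoid {V : Type*} (Γ : SimpleGraph V) (v u w : V) : Prop :=
  ∃ p : Γ.Walk u w, v ∉ p.support

/-- There is an injective homomorphism from the free abelian group of rank `r` into `G`. -/
def HasFreeAbelianSubgroupOfRank (G : Type*) [Group G] (r : ℕ) : Prop :=
  ∃ f : Multiplicative (Fin r →₀ ℤ) →* G, Function.Injective f

/-- The homomorphism out of a right-angled Artin group determined by images of the generators. -/
def raagLift {V G : Type*} [Group G] {Γ : SimpleGraph V} (f : V → G)
    (hf : ∀ v w, Γ.Adj v w → Commute (f v) (f w)) : RAAG Γ →* G :=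
  PresentedGroup.toGroup (f := f) (by
    rintro r ⟨v, w, h, rfl⟩
    simp [(hf v w h).eq])

@[simp] lemma raagLift_gen {V G : Type*} [Group G] {Γ : SimpleGraph V} (f : V → G)
    (hf : ∀ v w, Γ.Adj v w → Commute (f v) (f w)) (v : V) :
    raagLift f hf (raagGen Γ v) = f v :=
  PresentedGroup.toGroup.of _

lemma raag_hom_ext {V G : Type*} [Group G] {Γ : SimpleGraph V} {f g : RAAG Γ →* G}
    (h : ∀ v, f (raagGen Γ v) = g (raagGen Γ v)) : f = g :=
  PresentedGroup.ext h

lemma raagGen_commute {V : Type*} {Γ : SimpleGraph V} {v w : V} (h : Γ.Adj v w) :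
    Commute (raagGen Γ v) (raagGen Γ w) := by
  have : PresentedGroup.mk (raagRels Γ) (FreeGroup.of v * FreeGroup.of w *
      (FreeGroup.of v)⁻¹ * (FreeGroup.of w)⁻¹) = 1 :=
    PresentedGroup.one_of_mem ⟨v, w, h, rfl⟩
  simp only [map_mul, map_inv] at this
  exact mul_inv_eq_iff_eq_mul.mp (mul_inv_eq_one.mp this)

open Classical in
/-- The exponent sum of the generator `x`. -/
noncomputable def raagExp {V : Type*} (Γ : SimpleGraph V) (x : V) : RAAG Γ →* Multiplicative ℤ :=
  raagLift (fun v => if v = x then Multiplicative.ofAdd 1 else 1) fun _ _ _ => Commute.all _ _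

lemma raagExp_self {V : Type*} (Γ : SimpleGraph V) (x : V) :
    raagExp Γ x (raagGen Γ x) = Multiplicative.ofAdd 1 := by
  simp [raagExp]

lemma raagExp_of_ne {V : Type*} (Γ : SimpleGraph V) {x y : V} (h : y ≠ x) :
    raagExp Γ x (raagGen Γ y) = 1 := by
  simp [raagExp, h]

/-- An element commuting with a generator `x` has exponent sum zero in every generator
that is not adjacent to `x`. -/
lemma raagExp_eq_one_of_commute {V : Type*} {Γ : SimpleGraph V} {x y : V} (hne : x ≠ y)
    (hadj : ¬ Γ.Adj x y) {g : RAAG Γ} (hg : Commute g (raagGen Γ x)) : raagExp Γ y g = 1 := by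
  classical
  let S : ℚ ≃ₗ[ℚ] ℚ := LinearEquiv.smulOfNeZero ℚ ℚ 2 two_ne_zero
  let f : V → (ℚ ≃ᵃ[ℚ] ℚ) := fun v =>
    if v = x then AffineEquiv.constVAdd ℚ ℚ 1 else if v = y then S.toAffineEquiv else 1
  have hf : ∀ v w, Γ.Adj v w → Commute (f v) (f w) := by
    intro v w h
    have hvw := h.ne
    by_cases h1 : v = x
    · subst h1
      have h2 : w ≠ y := by rintro rfl; exact hadj h
      simp [f, h2, hvw.symm]
    by_cases h2 : v = y
    · subst h2
      have h2 : w ≠ x := by rintro rfl; exact hadj h.symm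
      simp [f, h2, hvw.symm]
    simp [f, h1, h2]
  let ψ : RAAG Γ →* (ℚ ≃ᵃ[ℚ] ℚ) := raagLift f hf
  have hlin : AffineEquiv.linearHom.comp ψ =
      (zpowersHom (ℚ ≃ₗ[ℚ] ℚ) S).comp (raagExp Γ y) := by
    refine raag_hom_ext fun v => ?_
    by_cases h1 : v = x
    · subst h1
      simp [ψ, f, raagExp_of_ne Γ hne]
      rfl
    by_cases h2 : v = y
    · subst h2
      simp [ψ, f, raagExp_self, h1]
      rfl
    simp [ψ, f, raagExp_of_ne Γ h2, h1, h2]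
    rfl
  have hl : (ψ g).linear = S ^ (Multiplicative.toAdd (raagExp Γ y g)) := by
    simpa using DFunLike.congr_fun hlin g
  have hc := (hg.map ψ).eq
  have hx : ψ (raagGen Γ x) = AffineEquiv.constVAdd ℚ ℚ 1 := by simp [ψ, f]
  rw [hx] at hc
  have h0 : ψ g ((1 : ℚ) +ᵥ (0 : ℚ)) = (1 : ℚ) +ᵥ ψ g 0 := DFunLike.congr_fun hc 0
  rw [AffineEquiv.map_vadd, vadd_eq_add, vadd_eq_add, add_left_inj, hl] at h0
  have hS : ∀ k : ℤ, (S ^ k) 1 = (2 : ℚ) ^ k := by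
    have key : ∀ (k : ℤ) (q : ℚ), (S ^ k) q = (2 : ℚ) ^ k * q := by
      intro k
      induction k with
      | zero => simp
      | succ n ih =>
        intro q
        rw [zpow_add_one, LinearEquiv.mul_apply, ih, zpow_add_one₀ two_ne_zero]
        simp [S, mul_assoc]
      | pred n ih =>
        intro q
        have := ih ((2 : ℚ)⁻¹ * q)
        have e : S ((2 : ℚ)⁻¹ * q) = q := by simp [S]
        rw [show (S ^ (-(n : ℤ)-1)) q = (S ^ (-(n : ℤ)-1)) (S ((2 : ℚ)⁻¹ * q)) by rw [e],
          ← LinearEquiv.mul_apply, ← zpow_add_one, sub_add_cancel, this,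
          zpow_sub_one₀ two_ne_zero, mul_assoc]
    intro k
    simpa using key k 1
  rw [hS, zpow_eq_one_iff_right₀ (by norm_num) (by norm_num)] at h0
  exact Multiplicative.toAdd.injective h0

/-- Parent pointers on a graph, oriented away from the edge joining `b` and `c`,
which are the parents of each other. -/
structure EdgeRooting {V : Type*} (Γ : SimpleGraph V) where
  b : V
  c : V
  p : V → V
  depth : V → ℕ
  p_b : p b = c
  p_c : p c = b
  adj : ∀ v, Γ.Adj v (p v)
  edge : ∀ {v w}, Γ.Adj v w → w = p v ∨ v = p w
  depth_lt : ∀ v, v ≠ b → v ≠ c → depth (p v) < depth v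

namespace EdgeRooting

variable {V : Type*} {Γ : SimpleGraph V} (R : EdgeRooting Γ)

lemma b_ne_c : R.b ≠ R.c := by
  have := (R.adj R.b).ne
  rwa [R.p_b] at this

lemma p_p_ne {v : V} (hb : v ≠ R.b) (hc : v ≠ R.c) : R.p (R.p v) ≠ v := by
  intro h
  have h1 := R.depth_lt v hb hc
  have h2 := R.depth_lt (R.p v) (fun e => hc (by rw [← h, e, R.p_b]))
    (fun e => hb (by rw [← h, e, R.p_c]))
  rw [h] at h2
  omega

lemma not_adj_p_p (v : V) : ¬ Γ.Adj v (R.p (R.p v)) := by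
  intro h
  rcases R.edge h with h1 | h1
  · exact (R.adj (R.p v)).ne h1.symm
  by_cases hb : v = R.b
  · subst hb; rw [R.p_b, R.p_c] at h; exact h.ne rfl
  by_cases hc : v = R.c
  · subst hc; rw [R.p_c, R.p_b] at h; exact h.ne rfl
  by_cases hb' : R.p v = R.b
  · rw [hb', R.p_b, R.p_c] at h1; exact hb h1
  by_cases hc' : R.p v = R.c
  · rw [hc', R.p_c, R.p_b] at h1; exact hc h1
  have := R.depth_lt v hb hc
  have := R.depth_lt _ hb' hc'
  by_cases hb'' : R.p (R.p v) = R.b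
  · rw [hb'', R.p_b] at h1; exact hc h1
  by_cases hc'' : R.p (R.p v) = R.c
  · rw [hc'', R.p_c] at h1; exact hb h1
  have := R.depth_lt _ hb'' hc''
  rw [← h1] at this
  omega

open Classical in
/-- The conjugating element at `v`: the product, from the root edge down to `v`, of the powers
`(p (p y)) ^ n y` over the ancestors `y` of `v`. -/
noncomputable def conjugator (n : V → ℤ) (v : V) : RAAG Γ :=
  if h : v ≠ R.b ∧ v ≠ R.c then
    have := R.depth_lt v h.1 h.2
    conjugator n (R.p v) * raagGen Γ (R.p (R.p v)) ^ n v
  else 1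
termination_by R.depth v

lemma conjugator_b (n : V → ℤ) : R.conjugator n R.b = 1 := by
  rw [conjugator]; simp

lemma conjugator_c (n : V → ℤ) : R.conjugator n R.c = 1 := by
  rw [conjugator]; simp

lemma conjugator_of_ne (n : V → ℤ) {v : V} (hb : v ≠ R.b) (hc : v ≠ R.c) :
    R.conjugator n v = R.conjugator n (R.p v) * raagGen Γ (R.p (R.p v)) ^ n v := by
  rw [conjugator, dif_pos ⟨hb, hc⟩]

lemma induction {P : V → Prop} (hb : P R.b) (hc : P R.c)
    (h : ∀ v, v ≠ R.b → v ≠ R.c → P (R.p v) → P (R.p (R.p v)) → P v) (v : V) : P v := by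
  induction hd : R.depth v using Nat.strong_induction_on generalizing v with
  | _ d ih =>
    subst hd
    by_cases h1 : v = R.b
    · exact h1 ▸ hb
    by_cases h2 : v = R.c
    · exact h2 ▸ hc
    have h3 := R.depth_lt v h1 h2
    have hp := ih _ h3 _ rfl
    refine h v h1 h2 hp ?_
    by_cases h1' : R.p v = R.b
    · rw [h1', R.p_b]; exact hc
    by_cases h2' : R.p v = R.c
    · rw [h2', R.p_c]; exact hb
    exact ih _ ((R.depth_lt _ h1' h2').trans h3) _ rfl

/-- The conjugators of a vertex and of its parent agree up to a power of the grandparent, hence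
have the same effect on the parent. -/
lemma conjugator_conj_p (n : V → ℤ) (v : V) :
    R.conjugator n v * raagGen Γ (R.p v) * (R.conjugator n v)⁻¹ =
      R.conjugator n (R.p v) * raagGen Γ (R.p v) * (R.conjugator n (R.p v))⁻¹ := by
  by_cases hb : v = R.b
  · subst hb; simp [R.p_b, conjugator_b, conjugator_c]
  by_cases hc : v = R.c
  · subst hc; simp [R.p_c, conjugator_b, conjugator_c]
  rw [R.conjugator_of_ne n hb hc]
  have := ((raagGen_commute (R.adj (R.p v))).zpow_right (n v)).eq
  generalize raagGen Γ (R.p (R.p v)) ^ n v = z at *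
  rw [mul_inv_rev, mul_assoc _ z, ← this]
  group

lemma conjugator_conj_p_p (n : V → ℤ) {v : V} (hb : v ≠ R.b) (hc : v ≠ R.c) :
    R.conjugator n v * raagGen Γ (R.p (R.p v)) * (R.conjugator n v)⁻¹ =
      R.conjugator n (R.p (R.p v)) * raagGen Γ (R.p (R.p v)) *
        (R.conjugator n (R.p (R.p v)))⁻¹ := by
  rw [← R.conjugator_conj_p n (R.p v), R.conjugator_of_ne n hb hc]
  group

open Classical in
/-- The transvection factor at `v`, trivial unless `v` has no children. -/
noncomputable def transvector (i j : V → ℤ) (v : V) : RAAG Γ :=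
  if v ∈ Set.range R.p then 1 else raagGen Γ (R.p (R.p v)) ^ i v * raagGen Γ (R.p v) ^ j v

lemma transvector_p (i j : V → ℤ) (v : V) : R.transvector i j (R.p v) = 1 := by
  simp [transvector]

lemma transvector_b (i j : V → ℤ) : R.transvector i j R.b = 1 := by
  rw [← R.p_c, transvector_p]

lemma transvector_c (i j : V → ℤ) : R.transvector i j R.c = 1 := by
  rw [← R.p_b, transvector_p]

lemma commute_transvector (i j : V → ℤ) (v : V) :
    Commute (raagGen Γ v * R.transvector i j v) (raagGen Γ (R.p v)) := by
  have h1 := raagGen_commute (R.adj v)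
  have h2 := (raagGen_commute (R.adj (R.p v))).symm
  unfold transvector
  split_ifs
  · simpa using h1
  · exact h1.mul_left ((h2.zpow_left _).mul_left ((Commute.refl _).zpow_left _))

/-- The endomorphism sending `v` to the conjugate by the conjugator of `v` of
`v` times the transvection factor. -/
noncomputable def endo (n i j : V → ℤ) : RAAG Γ →* RAAG Γ :=
  raagLift (fun v => R.conjugator n v * (raagGen Γ v * R.transvector i j v) *
    (R.conjugator n v)⁻¹) (by
    have key : ∀ v, Commute (R.conjugator n v * (raagGen Γ v * R.transvector i j v) *
        (R.conjugator n v)⁻¹) (R.conjugator n (R.p v) *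
        (raagGen Γ (R.p v) * R.transvector i j (R.p v)) * (R.conjugator n (R.p v))⁻¹) := by
      intro v
      rw [transvector_p, mul_one, ← conjugator_conj_p]
      exact (R.commute_transvector i j v).map (MulAut.conj (R.conjugator n v))
    intro v w h
    rcases R.edge h with rfl | rfl
    · exact key v
    · exact (key w).symm)

lemma endo_gen (n i j : V → ℤ) (v : V) : R.endo n i j (raagGen Γ v) =
    R.conjugator n v * (raagGen Γ v * R.transvector i j v) * (R.conjugator n v)⁻¹ := by
  simp [endo]

lemma endo_gen_p (n i j : V → ℤ) (v : V) : R.endo n i j (raagGen Γ (R.p v)) =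
    R.conjugator n v * raagGen Γ (R.p v) * (R.conjugator n v)⁻¹ := by
  rw [endo_gen, transvector_p, mul_one, conjugator_conj_p]

lemma endo_gen_p_p (n i j : V → ℤ) {v : V} (hb : v ≠ R.b) (hc : v ≠ R.c) :
    R.endo n i j (raagGen Γ (R.p (R.p v))) =
      R.conjugator n v * raagGen Γ (R.p (R.p v)) * (R.conjugator n v)⁻¹ := by
  rw [endo_gen, transvector_p, mul_one, conjugator_conj_p_p R n hb hc]

lemma endo_transvector (n i j i' j' : V → ℤ) (v : V) :
    R.endo n i j (R.transvector i' j' v) =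
      R.conjugator n v * R.transvector i' j' v * (R.conjugator n v)⁻¹ := by
  by_cases hb : v = R.b
  · subst hb; simp [transvector_b]
  by_cases hc : v = R.c
  · subst hc; simp [transvector_c]
  unfold transvector
  split_ifs
  · simp
  · rw [map_mul, map_zpow, map_zpow, endo_gen_p_p R n i j hb hc, endo_gen_p, conj_zpow,
      conj_zpow]
    group

lemma endo_conjugator (m n i j : V → ℤ) (v : V) :
    R.endo m i j (R.conjugator n v) = R.conjugator (m + n) v * (R.conjugator m v)⁻¹ := by
  induction v using R.induction with
  | hb => simp [conjugator_b]
  | hc => simp [conjugator_c]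
  | h v hb hc ih _ =>
    rw [R.conjugator_of_ne n hb hc, map_mul, ih, map_zpow, R.endo_gen_p m i j (R.p v), conj_zpow,
      R.conjugator_of_ne m hb hc, R.conjugator_of_ne (m + n) hb hc, Pi.add_apply, add_comm (m v),
      zpow_add]
    group

lemma transvector_add (i j i' j' : V → ℤ) (v : V) :
    R.transvector (i + i') (j + j') v = R.transvector i j v * R.transvector i' j' v := by
  unfold transvector
  split_ifs
  · simp
  · have h := ((raagGen_commute (R.adj (R.p v))).zpow_zpow (j v) (i' v)).eq
    rw [Pi.add_apply, Pi.add_apply, zpow_add, zpow_add]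
    simp only [mul_assoc]
    rw [← mul_assoc (_ ^ j v), h]
    simp only [mul_assoc]

lemma endo_comp (m i j n i' j' : V → ℤ) :
    (R.endo m i j).comp (R.endo n i' j') = R.endo (m + n) (i + i') (j + j') := by
  refine raag_hom_ext fun v => ?_
  rw [MonoidHom.comp_apply, endo_gen, map_mul, map_mul, map_mul, map_inv, endo_conjugator,
    endo_transvector, endo_gen, endo_gen, transvector_add]
  group

lemma conjugator_zero (v : V) : R.conjugator 0 v = 1 := by
  induction v using R.induction with
  | hb => exact R.conjugator_b 0
  | hc => exact R.conjugator_c 0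
  | h v hb hc ih _ => rw [R.conjugator_of_ne 0 hb hc, ih]; simp

lemma endo_zero : R.endo 0 0 0 = MonoidHom.id _ := by
  refine raag_hom_ext fun v => ?_
  simp [endo_gen, conjugator_zero, transvector]

/-- The homomorphism from triples of integer-valued functions on vertices to automorphisms. -/
noncomputable def aut :
    Multiplicative ((V → ℤ) × (V → ℤ) × (V → ℤ)) →* MulAut (RAAG Γ) where
  toFun x := MonoidHom.toMulEquiv (R.endo x.toAdd.1 x.toAdd.2.1 x.toAdd.2.2)
    (R.endo (-x.toAdd.1) (-x.toAdd.2.1) (-x.toAdd.2.2))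
    (by rw [endo_comp]; simp [endo_zero]) (by rw [endo_comp]; simp [endo_zero])
  map_one' := by
    ext g
    exact DFunLike.congr_fun R.endo_zero g
  map_mul' x y := by
    ext g
    exact (DFunLike.congr_fun (R.endo_comp x.toAdd.1 x.toAdd.2.1 x.toAdd.2.2
      y.toAdd.1 y.toAdd.2.1 y.toAdd.2.2) g).symm

lemma transvection_exponents_eq_zero {n i j : V → ℤ} {g : RAAG Γ}
    (hg : ∀ x, R.endo n i j x = g * x * g⁻¹) {v : V} (hv : v ∉ Set.range R.p) :
    i v = 0 ∧ j v = 0 := by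
  have hne := (R.adj (R.p v)).ne
  have key : ∀ x, raagExp Γ x (R.transvector i j v) = 1 := by
    intro x
    have := congrArg (raagExp Γ x) (hg (raagGen Γ v))
    rw [endo_gen] at this
    simp only [map_mul, map_inv] at this
    rwa [mul_right_comm, mul_inv_cancel, one_mul, mul_right_comm, mul_inv_cancel, one_mul,
      mul_eq_left] at this
  simp only [transvector, if_neg hv, map_mul, map_zpow] at key
  constructor
  · have := key (R.p (R.p v))
    rw [raagExp_self, raagExp_of_ne Γ hne, one_zpow, mul_one, ← ofAdd_zsmul] at this
    simpa using this
  · have := key (R.p v)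
    rw [raagExp_self, raagExp_of_ne Γ hne.symm, one_zpow, one_mul, ← ofAdd_zsmul] at this
    simpa using this

/-- An automorphism in the family is inner only if all its exponents vanish, provided the
conjugation exponents vanish at a child of `b` and a child of `c`. -/
lemma exponents_eq_zero {n i j : V → ℤ} {g : RAAG Γ}
    (hg : ∀ x, R.endo n i j x = g * x * g⁻¹) {vb vc : V} (hvb : R.p vb = R.c) (hvc : R.p vc = R.b)
    (hb : vb ≠ R.b) (hc : vc ≠ R.c) (hnb : n vb = 0) (hnc : n vc = 0) {v : V}
    (hvb' : v ≠ R.b) (hvc' : v ≠ R.c) : n v = 0 := by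
  have ht : ∀ v, R.transvector i j v = 1 := by
    intro v
    by_cases hv : v ∈ Set.range R.p
    · simp [transvector, hv]
    · obtain ⟨h1, h2⟩ := R.transvection_exponents_eq_zero hg hv
      simp [transvector, h1, h2]
  have hcomm : ∀ v, R.conjugator n v = 1 → Commute g (raagGen Γ v) := by
    intro v hv
    have := hg (raagGen Γ v)
    rw [endo_gen, hv, ht] at this
    exact (mul_inv_eq_iff_eq_mul.mp (by simpa using this.symm))
  have hbc : vb ≠ R.c := by
    rintro rfl
    exact R.b_ne_c (R.p_c.symm.trans hvb)
  have hcb : vc ≠ R.b := by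
    rintro rfl
    exact R.b_ne_c (hvc.symm.trans R.p_b)
  have hCb := hcomm _ (R.conjugator_b n)
  have hCc := hcomm _ (R.conjugator_c n)
  have hCvb := hcomm vb (by rw [R.conjugator_of_ne n hb hbc, hvb, conjugator_c, hnb]; simp)
  have hCvc := hcomm vc (by rw [R.conjugator_of_ne n hcb hc, hvc, conjugator_b, hnc]; simp)
  have hexp : ∀ u, raagExp Γ u g = 1 := by
    intro u
    by_cases hub : u = R.b
    · subst hub
      refine raagExp_eq_one_of_commute hb ?_ hCvb
      have := R.not_adj_p_p vb
      rwa [hvb, R.p_c] at this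
    by_cases huc : u = R.c
    · subst huc
      refine raagExp_eq_one_of_commute hc ?_ hCvc
      have := R.not_adj_p_p vc
      rwa [hvc, R.p_b] at this
    by_cases hadj : Γ.Adj R.b u
    · refine raagExp_eq_one_of_commute (Ne.symm huc) (fun h => ?_) hCc
      rcases R.edge hadj with h1 | h1
      · exact huc (h1.trans R.p_b)
      rcases R.edge h with h2 | h2
      · exact hub (h2.trans R.p_c)
      · exact R.b_ne_c (h1.trans h2.symm)
    · exact raagExp_eq_one_of_commute (Ne.symm hub) hadj hCb
  have hall : ∀ v, R.conjugator n v = 1 ∧ (v ≠ R.b → v ≠ R.c → n v = 0) := by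
    intro v
    induction v using R.induction with
    | hb => exact ⟨R.conjugator_b n, fun h => absurd rfl h⟩
    | hc => exact ⟨R.conjugator_c n, fun _ h => absurd rfl h⟩
    | h v h1 h2 ih _ =>
      have hconj := R.conjugator_of_ne n h1 h2
      rw [ih.1, one_mul] at hconj
      have hn : n v = 0 := by
        have hgv := hg (raagGen Γ v)
        rw [endo_gen, ht, mul_one, hconj] at hgv
        have hk : Commute ((raagGen Γ (R.p (R.p v)) ^ n v)⁻¹ * g) (raagGen Γ v) := by
          have : (raagGen Γ (R.p (R.p v)) ^ n v)⁻¹ * (g * raagGen Γ v * g⁻¹) * g =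
            (raagGen Γ (R.p (R.p v)) ^ n v)⁻¹ * (raagGen Γ (R.p (R.p v)) ^ n v * raagGen Γ v *
              (raagGen Γ (R.p (R.p v)) ^ n v)⁻¹) * g := by rw [hgv]
          simpa [Commute, SemiconjBy, mul_assoc] using this
        have := raagExp_eq_one_of_commute (R.p_p_ne h1 h2).symm (R.not_adj_p_p v) hk
        rw [map_mul, hexp, map_inv, map_zpow, raagExp_self, ← ofAdd_zsmul] at this
        simpa using this
      exact ⟨by rw [hconj, hn, zpow_zero], fun _ _ => hn⟩
  exact (hall v).2 hvb' hvc'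

end EdgeRooting

/-- In a connected graph, every vertex other than `r` has a neighbor closer to `r`. -/
lemma exists_adj_dist_eq_add_one {V : Type*} {Γ : SimpleGraph V} (h : Γ.Connected) {r v : V}
    (hv : v ≠ r) : ∃ w, Γ.Adj v w ∧ Γ.dist r v = Γ.dist r w + 1 := by
  obtain ⟨q, hq⟩ := h.exists_walk_length_eq_dist v r
  cases q with
  | nil => exact absurd rfl hv
  | @cons _ w _ hadj q' =>
    refine ⟨w, hadj, ?_⟩
    rw [SimpleGraph.Walk.length_cons, SimpleGraph.dist_comm] at hq
    have h1 := SimpleGraph.dist_le q'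
    rw [SimpleGraph.dist_comm] at h1
    have h2 := hadj.diff_dist_adj (u := r)
    omega

/-- In a tree, the neighbor of a vertex closer to `r` is unique. -/
lemma eq_of_adj_of_dist_eq_add_one {V : Type*} {Γ : SimpleGraph V} (h : Γ.IsTree) {r v w w' : V}
    (hw : Γ.Adj v w) (hw' : Γ.Adj v w') (hd : Γ.dist r v = Γ.dist r w + 1)
    (hd' : Γ.dist r v = Γ.dist r w' + 1) : w = w' := by
  obtain ⟨q, hq⟩ := h.connected.exists_walk_length_eq_dist r w
  obtain ⟨q', hq'⟩ := h.connected.exists_walk_length_eq_dist r w'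
  have h1 : (q.concat hw.symm).IsPath := by
    apply SimpleGraph.Walk.isPath_of_length_eq_dist
    rw [SimpleGraph.Walk.length_concat, hq, hd]
  have h2 : (q'.concat hw'.symm).IsPath := by
    apply SimpleGraph.Walk.isPath_of_length_eq_dist
    rw [SimpleGraph.Walk.length_concat, hq', hd']
  have h3 := congrArg SimpleGraph.Walk.penultimate ((h.existsUnique_path r v).unique h1 h2)
  simpa using h3

/-- Every edge of a tree is the root edge of a rooting. -/
lemma exists_edgeRooting {V : Type*} {Γ : SimpleGraph V} (h : Γ.IsTree) {b c : V}
    (hbc : Γ.Adj b c) : ∃ R : EdgeRooting Γ, R.b = b ∧ R.c = c := by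
  classical
  choose! q hq hqd using fun v (hv : v ≠ b) => exists_adj_dist_eq_add_one h.connected hv
  have hq_unique : ∀ {v w}, v ≠ b → Γ.Adj v w → Γ.dist b v = Γ.dist b w + 1 → w = q v :=
    fun hv hw hd => eq_of_adj_of_dist_eq_add_one h hw (hq _ hv) hd (hqd _ hv)
  have hne_of_dist : ∀ {v w}, Γ.dist b v = Γ.dist b w + 1 → v ≠ b := by
    rintro v w hd rfl
    simp at hd
  have hc : q c = b := (hq_unique hbc.ne' hbc.symm (by
    rw [SimpleGraph.dist_self, SimpleGraph.dist_eq_one_iff_adj.mpr hbc])).symm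
  exact ⟨{
    b := b
    c := c
    p := fun v => if v = b then c else q v
    depth := Γ.dist b
    p_b := if_pos rfl
    p_c := by rw [if_neg hbc.ne', hc]
    adj := fun v => by
      split_ifs with hv
      · exact hv ▸ hbc
      · exact hq v hv
    edge := fun {v w} hvw => by
      rcases h.dist_eq_dist_add_one_of_adj b hvw with hd | hd
      · have hv := hne_of_dist hd
        exact Or.inl (by rw [if_neg hv]; exact hq_unique hv hvw hd)
      · have hw := hne_of_dist hd
        exact Or.inr (by rw [if_neg hw]; exact hq_unique hw hvw.symm hd)
    depth_lt := fun v hv _ => by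
      rw [if_neg hv, hqd v hv]
      exact Nat.lt_succ_self _ }, rfl, rfl⟩

lemma exists_adj_ne {V : Type*} {Γ : SimpleGraph V} {v : V} (h : 2 ≤ (Γ.neighborSet v).ncard)
    (x : V) : ∃ w, Γ.Adj v w ∧ w ≠ x :=
  Set.exists_ne_of_one_lt_ncard h x

lemma two_le_ncard_neighborSet {V : Type*} [Finite V] {Γ : SimpleGraph V} {v x y : V}
    (hx : Γ.Adj v x) (hy : Γ.Adj v y) (hne : x ≠ y) : 2 ≤ (Γ.neighborSet v).ncard :=
  (Set.one_lt_ncard).mpr ⟨x, hx, y, hy, hne⟩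

/-- In a connected graph with a vertex `a` of degree at least two, every other vertex has a
neighbor of degree at least two. -/
lemma exists_adj_two_le_ncard {V : Type*} [Finite V] {Γ : SimpleGraph V} (h : Γ.Connected)
    {a b : V} (hab : a ≠ b) (ha : 2 ≤ (Γ.neighborSet a).ncard) :
    ∃ c, Γ.Adj b c ∧ 2 ≤ (Γ.neighborSet c).ncard := by
  obtain ⟨c, hbc, hd⟩ := exists_adj_dist_eq_add_one h hab.symm
  refine ⟨c, hbc, ?_⟩
  by_cases hca : c = a
  · exact hca ▸ ha
  obtain ⟨x, hcx, hd'⟩ := exists_adj_dist_eq_add_one h hca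
  refine two_le_ncard_neighborSet hbc.symm hcx ?_
  rintro rfl
  omega

lemma EdgeRooting.exists_child {V : Type*} {Γ : SimpleGraph V} (R : EdgeRooting Γ) {v : V}
    (hv : 2 ≤ (Γ.neighborSet v).ncard) : ∃ w, R.p w = v ∧ w ≠ R.p v := by
  obtain ⟨w, hw, hne⟩ := exists_adj_ne hv (R.p v)
  rcases R.edge hw with h | h
  · exact absurd h hne
  · exact ⟨w, h.symm, hne⟩

lemma EdgeRooting.not_mem_range_of_isLeaf {V : Type*} [Finite V] {Γ : SimpleGraph V}
    (R : EdgeRooting Γ) (hb : 2 ≤ (Γ.neighborSet R.b).ncard)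
    (hc : 2 ≤ (Γ.neighborSet R.c).ncard) {v : V} (hv : IsLeaf Γ v) : v ∉ Set.range R.p := by
  rintro ⟨w, rfl⟩
  unfold IsLeaf at hv
  have hwb : w ≠ R.b := by rintro rfl; rw [R.p_b] at hv; omega
  have hwc : w ≠ R.c := by rintro rfl; rw [R.p_c] at hv; omega
  have := two_le_ncard_neighborSet (R.adj w).symm (R.adj (R.p w)) (R.p_p_ne hwb hwc).symm
  omega

open Classical in
/-- The parameters used for the free abelian subgroup: conjugation exponents away from four
vertices, and two transvection exponents for every leaf. -/
noncomputable def parameterSet {V : Type*} [Fintype V] (Γ : SimpleGraph V) (F : Finset V) :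
    Finset (V ⊕ V ⊕ V) :=
  Fᶜ.disjSum ((Finset.univ.filter (IsLeaf Γ)).disjSum (Finset.univ.filter (IsLeaf Γ)))

lemma card_parameterSet {V : Type*} [Fintype V] (Γ : SimpleGraph V) (F : Finset V) :
    (parameterSet Γ F).card = (Fintype.card V - F.card) + 2 * numLeaves Γ := by
  classical
  have : numLeaves Γ = (Finset.univ.filter (IsLeaf Γ)).card := by
    rw [numLeaves, Set.ncard_eq_toFinset_card', Set.toFinset_ofPred]
  rw [parameterSet, Finset.card_disjSum, Finset.card_disjSum, Finset.card_compl, this, two_mul]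

/-- Splitting an integer vector indexed by three copies of `V` into three functions. -/
def splitHom (V : Type*) : ((V ⊕ V ⊕ V) →₀ ℤ) →+ (V → ℤ) × (V → ℤ) × (V → ℤ) where
  toFun x := (fun v => x (.inl v), fun v => x (.inr (.inl v)), fun v => x (.inr (.inr v)))
  map_zero' := rfl
  map_add' _ _ := rfl

theorem EdgeRooting.hasFreeAbelianSubgroupOfRank {V : Type*} [Fintype V] [DecidableEq V]
    {Γ : SimpleGraph V} (R : EdgeRooting Γ) (hb : 2 ≤ (Γ.neighborSet R.b).ncard)
    (hc : 2 ≤ (Γ.neighborSet R.c).ncard) {vb vc : V} (hvb : R.p vb = R.c) (hvc : R.p vc = R.b)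
    (hvb' : vb ≠ R.b) (hvc' : vc ≠ R.c) :
    HasFreeAbelianSubgroupOfRank (OutG (RAAG Γ))
      (parameterSet Γ {R.b, R.c, vb, vc}).card := by
  set S := parameterSet Γ {R.b, R.c, vb, vc} with hS
  let e : Fin S.card → V ⊕ V ⊕ V := fun k => (S.equivFin.symm k : V ⊕ V ⊕ V)
  have he : Function.Injective e := Subtype.val_injective.comp S.equivFin.symm.injective
  let E : (Fin S.card →₀ ℤ) →+ ((V ⊕ V ⊕ V) →₀ ℤ) := Finsupp.mapDomain.addMonoidHom e
  let f : Multiplicative (Fin S.card →₀ ℤ) →* OutG (RAAG Γ) :=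
    (outMk _).comp (R.aut.comp (AddMonoidHom.toMultiplicative ((splitHom V).comp E)))
  refine ⟨f, (injective_iff_map_eq_one f).mpr fun x hx => ?_⟩
  obtain ⟨g, hg⟩ := (QuotientGroup.eq_one_iff _).mp hx
  let y := E x.toAdd
  have hg' : ∀ a, R.endo (splitHom V y).1 (splitHom V y).2.1 (splitHom V y).2.2 a =
      g * a * g⁻¹ := fun a => (DFunLike.congr_fun hg a).symm
  have hout : ∀ k ∉ S, y k = 0 := by
    intro k hk
    refine Finsupp.mapDomain_of_notMem_range _ _ ?_
    rintro ⟨a, rfl⟩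
    exact hk (S.equivFin.symm a).2
  have hF : ∀ v ∈ ({R.b, R.c, vb, vc} : Finset V), y (.inl v) = 0 := fun v hv =>
    hout _ (by
      simpa only [hS, parameterSet, Finset.inl_mem_disjSum, Finset.mem_compl, not_not] using hv)
  have hL : ∀ v, IsLeaf Γ v → y (.inr (.inl v)) = 0 ∧ y (.inr (.inr v)) = 0 := fun v hv =>
    R.transvection_exponents_eq_zero hg' (R.not_mem_range_of_isLeaf hb hc hv)
  have hy : y = 0 := by
    ext k
    rcases k with v | v | v
    · by_cases h1 : v = R.b
      · exact hF v (by simp [h1])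
      by_cases h2 : v = R.c
      · exact hF v (by simp [h2])
      exact R.exponents_eq_zero hg' hvb hvc hvb' hvc' (hF vb (by simp)) (hF vc (by simp)) h1 h2
    · by_cases h : IsLeaf Γ v
      · exact (hL v h).1
      · exact hout _ (by simp [hS, parameterSet, h])
    · by_cases h : IsLeaf Γ v
      · exact (hL v h).2
      · exact hout _ (by simp [hS, parameterSet, h])
  exact Multiplicative.toAdd.injective
    (Finsupp.mapDomain_injective he (hy.trans Finsupp.mapDomain_zero.symm))

/-- Let `Γ` be a finite tree with `e` edges and `ℓ` leaves which
has at least two vertices of degree ≥ 2 (i.e. `Γ` is not a star).  Then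
`Out(A_Γ)` contains a free abelian subgroup of rank `e + 2ℓ - 3`. -/
theorem tree_out_raag_free_abelian_lower_bound
    {V : Type*} [Fintype V] (Γ : SimpleGraph V) (hΓ : Γ.IsTree)
    (hnotstar : ∃ a b : V, a ≠ b ∧
      2 ≤ (Γ.neighborSet a).ncard ∧ 2 ≤ (Γ.neighborSet b).ncard) :
    HasFreeAbelianSubgroupOfRank (OutG (RAAG Γ))
      (Nat.card Γ.edgeSet + 2 * numLeaves Γ - 3) := by
  classical
  obtain ⟨a, b, hab, ha, hb⟩ := hnotstar
  obtain ⟨c, hbc, hc⟩ := exists_adj_two_le_ncard hΓ.connected hab ha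
  obtain ⟨R, rfl, rfl⟩ := exists_edgeRooting hΓ hbc
  obtain ⟨vb, hvb, hvb'⟩ := R.exists_child hc
  obtain ⟨vc, hvc, hvc'⟩ := R.exists_child hb
  rw [R.p_c] at hvb'
  rw [R.p_b] at hvc'
  have hF : ({R.b, R.c, vb, vc} : Finset V).card = 4 := by
    have h1 : R.c ≠ vb := by rintro rfl; exact R.b_ne_c (R.p_c.symm.trans hvb)
    have h2 : R.b ≠ vc := by rintro rfl; exact R.b_ne_c (hvc.symm.trans R.p_b)
    have h3 : vb ≠ vc := by rintro rfl; exact R.b_ne_c (hvc.symm.trans hvb)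
    simp [R.b_ne_c, hvb'.symm, hvc'.symm, h1, h2, h3]
  have hcard : 4 ≤ Fintype.card V := hF ▸ Finset.card_le_univ _
  have hedges : Nat.card Γ.edgeSet + 1 = Fintype.card V := by
    rw [← Nat.card_eq_fintype_card]
    exact (SimpleGraph.isTree_iff_connected_and_card.mp hΓ).2
  have := R.hasFreeAbelianSubgroupOfRank hb hc hvb hvc hvb' hvc'
  rw [card_parameterSet, hF] at this
  convert this using 1
  omega
end
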